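/- Let ν, μ ∈ ℂ and let t ∈ ℝ with |t| < √2/2. Then P_ν^{-μ}(t) = (√π / 2^μ) · ∑_{n=0}^∞ (-1)^n (μ - ν)_n · t^n · (1 - t²)^{(ν-n)/2} / (Γ((n + μ - ν + 1)/2) · Γ((μ + ν - n + 2)/2) · n!), the series converging. -/

import Mathlib

noncomputable def pochC (a : ℂ) (n : ℕ) : ℂ := (ascPochhammer ℂ n).eval a

/-- Ferrers function of the first kind `P_ν^μ(x)`. -/
noncomputable def ferrersP (ν μ : ℂ) (x : ℝ) : ℂ :=
  (((1 + x) / (1 - x) : ℝ) : ℂ) ^ (μ / 2) *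
    ∑' n : ℕ, pochC (-ν) n * pochC (ν + 1) n /
        (Complex.Gamma ((n : ℂ) + 1 - μ) * (n.factorial : ℂ)) *
      (((1 - x) / 2 : ℝ) : ℂ) ^ n

open Filter Topology

section PowerSeries

/-- The power series with coefficients `a` converges absolutely on the open unit disc. -/
def UnitDiscSummable (a : ℕ → ℂ) : Prop :=
  ∀ r : ℝ, 0 ≤ r → r < 1 → Summable fun n => ‖a n‖ * r ^ n

theorem UnitDiscSummable.summable {a : ℕ → ℂ} (ha : UnitDiscSummable a) {z : ℂ} (hz : ‖z‖ < 1) :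
    Summable fun n => a n * z ^ n :=
  Summable.of_norm <| by simpa using ha ‖z‖ (norm_nonneg z) hz

theorem UnitDiscSummable.hasSum_deriv {a : ℕ → ℂ} (ha : UnitDiscSummable a) {z : ℂ}
    (hz : ‖z‖ < 1) :
    HasSum (fun n : ℕ => ((n : ℂ) + 1) * a (n + 1) * z ^ n)
      (deriv (fun w => ∑' n, a n * w ^ n) z) := by
  obtain ⟨r, hzr, hr1⟩ := exists_between hz
  have h := Complex.hasSum_deriv_of_summable_norm (F := fun n w => a n * w ^ n)
    (ha r ((norm_nonneg z).trans hzr.le) hr1) (U := Metric.ball 0 r)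
    (fun i => by fun_prop) Metric.isOpen_ball
    (fun i w hw => by
      rw [norm_mul, norm_pow]
      have : ‖w‖ ≤ r := by simpa using (mem_ball_zero_iff.mp hw).le
      gcongr) (mem_ball_zero_iff.mpr hzr)
  rw [← hasSum_nat_add_iff' 1] at h
  simp only [Finset.range_one, Finset.sum_singleton, pow_zero, deriv_const, sub_zero] at h
  refine h.congr_fun fun n => ?_
  simp
  ring

theorem UnitDiscSummable.differentiableAt {a : ℕ → ℂ} (ha : UnitDiscSummable a) {z : ℂ}
    (hz : ‖z‖ < 1) : DifferentiableAt ℂ (fun w => ∑' n, a n * w ^ n) z := by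
  obtain ⟨r, hzr, hr1⟩ := exists_between hz
  refine (Complex.differentiableOn_tsum_of_summable_norm (F := fun n w => a n * w ^ n)
    (ha r ((norm_nonneg z).trans hzr.le) hr1) (U := Metric.ball 0 r)
    (fun i => by fun_prop) Metric.isOpen_ball
    (fun i w hw => ?_)).differentiableAt (Metric.isOpen_ball.mem_nhds (mem_ball_zero_iff.mpr hzr))
  rw [norm_mul, norm_pow]
  have : ‖w‖ ≤ r := by simpa using (mem_ball_zero_iff.mp hw).le
  gcongr

theorem unitDiscSummable_of_recurrence {a p q : ℕ → ℂ} {c : ℂ}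
    (hrec : ∀ n, p n * a (n + 1) = q n * a n) (hp : ∀ᶠ n in atTop, p n ≠ 0)
    (hlim : Tendsto (fun n => q n / p n) atTop (𝓝 c)) (hc : ‖c‖ ≤ 1) : UnitDiscSummable a := by
  intro r hr0 hr1
  obtain ⟨s, hrs, hs1⟩ := exists_between hr1
  refine summable_of_ratio_norm_eventually_le hs1 ?_
  have h1 : Tendsto (fun n => ‖q n / p n‖ * r) atTop (𝓝 (‖c‖ * r)) := hlim.norm.mul_const r
  have h2 : ‖c‖ * r < s := (mul_le_of_le_one_left hr0 hc).trans_lt hrs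
  filter_upwards [hp, h1.eventually_le_const h2] with n hn hle
  have h3 : a (n + 1) = q n / p n * a n := by
    field_simp
    linear_combination hrec n
  rw [h3, norm_mul]
  simp only [norm_mul, norm_norm, norm_pow, Real.norm_of_nonneg hr0, pow_succ]
  calc ‖q n / p n‖ * ‖a n‖ * (r ^ n * r) = ‖q n / p n‖ * r * (‖a n‖ * r ^ n) := by ring
    _ ≤ s * (‖a n‖ * r ^ n) := by gcongr

theorem unitDiscSummable_of_even_odd {a : ℕ → ℂ} (he : UnitDiscSummable fun n => a (2 * n))
    (ho : UnitDiscSummable fun n => a (2 * n + 1)) : UnitDiscSummable a := by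
  intro r hr0 hr1
  have hr : r ^ 2 < 1 := by nlinarith
  refine (HasSum.even_add_odd (f := fun n => ‖a n‖ * r ^ n)
    (Summable.hasSum ?_) (Summable.hasSum ?_)).summable
  · refine (he (r ^ 2) (sq_nonneg r) hr).congr fun n => ?_
    rw [pow_mul]
  · refine ((ho (r ^ 2) (sq_nonneg r) hr).mul_right r).congr fun n => ?_
    rw [pow_succ _ (2 * n), pow_mul, mul_assoc]

theorem unitDiscSummable_of_two_step_recurrence {a p q : ℕ → ℂ} {c : ℂ}
    (hrec : ∀ n, p n * a (n + 2) = q n * a n) (hp : ∀ n, p n ≠ 0)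
    (hlim : Tendsto (fun n => q n / p n) atTop (𝓝 c)) (hc : ‖c‖ ≤ 1) : UnitDiscSummable a := by
  have h2 : Tendsto (fun n : ℕ => 2 * n) atTop atTop := tendsto_id.const_mul_atTop' two_pos
  refine unitDiscSummable_of_even_odd ?_ ?_
  · exact unitDiscSummable_of_recurrence (p := fun n => p (2 * n)) (q := fun n => q (2 * n))
      (fun n => hrec (2 * n)) (Eventually.of_forall fun n => hp (2 * n)) (hlim.comp h2) hc
  · exact unitDiscSummable_of_recurrence (p := fun n => p (2 * n + 1))
      (q := fun n => q (2 * n + 1)) (fun n => hrec (2 * n + 1))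
      (Eventually.of_forall fun n => hp (2 * n + 1))
      (hlim.comp ((tendsto_add_atTop_nat 1).comp h2)) hc

theorem tendsto_natCast_add_div_add (a b : ℂ) :
    Tendsto (fun n : ℕ => ((n : ℂ) + a) / (n + b)) atTop (𝓝 1) := by
  have h := (tendsto_natCast_div_add_atTop b).div (tendsto_natCast_div_add_atTop a) one_ne_zero
  rw [div_one] at h
  refine h.congr' ?_
  filter_upwards [eventually_ne_atTop 0] with n hn
  have : (n : ℂ) ≠ 0 := Nat.cast_ne_zero.mpr hn
  simp only [Pi.div_apply]
  rw [div_div_div_eq, mul_comm (n : ℂ), mul_div_mul_right _ _ this]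

theorem eventually_natCast_add_ne_zero (b : ℂ) : ∀ᶠ n : ℕ in atTop, (n : ℂ) + b ≠ 0 := by
  filter_upwards [(tendsto_natCast_add_div_add b b).eventually_ne one_ne_zero] with n hn h
  exact hn (by rw [h, div_zero])

end PowerSeries

section Coefficients

theorem pochC_zero (a : ℂ) : pochC a 0 = 1 := by simp [pochC]

theorem pochC_succ (a : ℂ) (n : ℕ) : pochC a (n + 1) = pochC a n * (a + n) := by
  rw [pochC, ascPochhammer_succ_eval, pochC]

theorem pochC_succ_left (a : ℂ) (n : ℕ) : pochC a (n + 1) = a * pochC (a + 1) n := by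
  simp [pochC, ascPochhammer_succ_left]

theorem Gamma_inv_eq_mul (z : ℂ) : (Complex.Gamma z)⁻¹ = z * (Complex.Gamma (z + 1))⁻¹ := by
  simpa using Complex.one_div_Gamma_eq_self_mul_one_div_Gamma_add_one z

/-- The coefficients of the power series in the definition of `P_ν^{-μ}`. -/
noncomputable def ferrersCoeff (ν μ : ℂ) (n : ℕ) : ℂ :=
  pochC (-ν) n * pochC (ν + 1) n / (Complex.Gamma ((n : ℂ) + 1 + μ) * (n.factorial : ℂ))

/-- The coefficients of the expansion of `P_ν^{-μ}` in powers of `t / √(1 - t²)`. -/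
noncomputable def expansionCoeff (ν μ : ℂ) (n : ℕ) : ℂ :=
  (-1 : ℂ) ^ n * pochC (μ - ν) n /
    (Complex.Gamma (((n : ℂ) + μ - ν + 1) / 2) * Complex.Gamma ((μ + ν - (n : ℂ) + 2) / 2) *
      (n.factorial : ℂ))

theorem ferrersCoeff_succ (ν μ : ℂ) (n : ℕ) :
    ((n : ℂ) + (1 + μ)) * (n + 1) * ferrersCoeff ν μ (n + 1) =
      (n + -ν) * (n + (ν + 1)) * ferrersCoeff ν μ n := by
  have h := Gamma_inv_eq_mul ((n : ℂ) + 1 + μ)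
  have hn : (n : ℂ) + 1 ≠ 0 := Nat.cast_add_one_ne_zero n
  have hf : (n.factorial : ℂ) ≠ 0 := Nat.cast_ne_zero.mpr n.factorial_ne_zero
  rw [show (n : ℂ) + 1 + μ + 1 = (n : ℂ) + 1 + 1 + μ by ring] at h
  simp only [ferrersCoeff, pochC_succ, Nat.factorial_succ, Nat.cast_mul, Nat.cast_add,
    Nat.cast_one, div_eq_mul_inv, mul_inv]
  rw [h]
  field_simp
  ring

theorem unitDiscSummable_ferrersCoeff (ν μ : ℂ) : UnitDiscSummable (ferrersCoeff ν μ) := by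
  refine unitDiscSummable_of_recurrence (c := 1 * 1) (ferrersCoeff_succ ν μ) ?_ ?_ (by simp)
  · filter_upwards [eventually_natCast_add_ne_zero (1 + μ)] with n hn
    exact mul_ne_zero hn (Nat.cast_add_one_ne_zero n)
  · simpa only [mul_div_mul_comm] using
      (tendsto_natCast_add_div_add (-ν) (1 + μ)).mul (tendsto_natCast_add_div_add (ν + 1) 1)

theorem expansionCoeff_add_two (ν μ : ℂ) (n : ℕ) :
    ((n : ℂ) + 1) * (n + 2) * expansionCoeff ν μ (n + 2) =
      -(((n : ℂ) + (μ - ν)) * (n + -(μ + ν))) * expansionCoeff ν μ n := by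
  have h1 := Gamma_inv_eq_mul (((n : ℂ) + μ - ν + 1) / 2)
  have h2 := Gamma_inv_eq_mul ((μ + ν - (n : ℂ)) / 2)
  have hn : (n : ℂ) + 1 ≠ 0 := Nat.cast_add_one_ne_zero n
  have hn2 : (n : ℂ) + 1 + 1 ≠ 0 := mod_cast Nat.succ_ne_zero (n + 1)
  have hf : (n.factorial : ℂ) ≠ 0 := Nat.cast_ne_zero.mpr n.factorial_ne_zero
  rw [show ((n : ℂ) + μ - ν + 1) / 2 + 1 = ((n : ℂ) + 1 + 1 + μ - ν + 1) / 2 by ring] at h1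
  rw [show (μ + ν - (n : ℂ)) / 2 + 1 = (μ + ν - (n : ℂ) + 2) / 2 by ring,
    show (μ + ν - (n : ℂ)) / 2 = (μ + ν - ((n : ℂ) + 1 + 1) + 2) / 2 by ring] at h2
  simp only [expansionCoeff, pochC_succ, Nat.factorial_succ, Nat.cast_mul, Nat.cast_add,
    Nat.cast_one, div_eq_mul_inv, mul_inv, show n + 2 = n + 1 + 1 from rfl] at h1 h2 ⊢
  rw [h1, h2]
  field_simp
  ring

theorem unitDiscSummable_expansionCoeff (ν μ : ℂ) : UnitDiscSummable (expansionCoeff ν μ) := by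
  have hlim : Tendsto (fun n : ℕ => -(((n : ℂ) + (μ - ν)) * (n + -(μ + ν))) /
      (((n : ℂ) + 1) * (n + 2))) atTop (𝓝 (-(1 * 1))) := by
    simpa only [mul_div_mul_comm, neg_div] using
      ((tendsto_natCast_add_div_add (μ - ν) 1).mul
        (tendsto_natCast_add_div_add (-(μ + ν)) 2)).neg
  exact unitDiscSummable_of_two_step_recurrence (expansionCoeff_add_two ν μ)
    (fun n => mul_ne_zero (mod_cast n.succ_ne_zero) (mod_cast (n + 1).succ_ne_zero)) hlim (by simp)

theorem ferrersCoeff_ladder (ν μ : ℂ) (n : ℕ) :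
    (ν - μ - 2 * ((n : ℂ) + 1)) * ferrersCoeff ν μ (n + 1) -
      (ν - μ) * ferrersCoeff (ν - 1) μ (n + 1) = (2 * ν - 2 * n) * ferrersCoeff ν μ n := by
  have h := Gamma_inv_eq_mul ((n : ℂ) + 1 + μ)
  have hn : (n : ℂ) + 1 ≠ 0 := Nat.cast_add_one_ne_zero n
  have hf : (n.factorial : ℂ) ≠ 0 := Nat.cast_ne_zero.mpr n.factorial_ne_zero
  rw [show (n : ℂ) + 1 + μ + 1 = (n : ℂ) + 1 + 1 + μ by ring] at h
  have e1 : pochC (-ν) n * (-ν + n) = -ν * pochC (-ν + 1) n := by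
    rw [← pochC_succ, pochC_succ_left]
  have e2 : pochC (-ν + 1) (n + 1) = pochC (-ν + 1) n * (-ν + 1 + n) := pochC_succ _ _
  have e3 : pochC ν (n + 1) = ν * pochC (ν + 1) n := pochC_succ_left _ _
  simp only [ferrersCoeff, sub_add_cancel, show -(ν - 1) = -ν + 1 by ring, e2, e3,
    pochC_succ (ν + 1), pochC_succ (-ν), e1, Nat.factorial_succ, Nat.cast_mul, Nat.cast_add,
    Nat.cast_one, div_eq_mul_inv, mul_inv]
  rw [h]
  field_simp
  linear_combination (2 * (n + 1) * ((n : ℂ) + 1 + μ) * pochC (ν + 1) n *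
    (Complex.Gamma ((n : ℂ) + 1 + 1 + μ))⁻¹) * e1

theorem expansionCoeff_ladder (ν μ : ℂ) (n : ℕ) :
    ((n : ℂ) + 1) * expansionCoeff ν μ (n + 1) = (ν - μ) * expansionCoeff (ν - 1) μ n := by
  have hn : (n : ℂ) + 1 ≠ 0 := Nat.cast_add_one_ne_zero n
  have hf : (n.factorial : ℂ) ≠ 0 := Nat.cast_ne_zero.mpr n.factorial_ne_zero
  simp only [expansionCoeff, pochC_succ_left, Nat.factorial_succ, Nat.cast_mul, Nat.cast_add,
    Nat.cast_one, pow_succ, show μ - (ν - 1) = μ - ν + 1 by ring,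
    show (n : ℂ) + μ - (ν - 1) + 1 = n + 1 + μ - ν + 1 by ring,
    show μ + (ν - 1) - (n : ℂ) + 2 = μ + ν - (n + 1) + 2 by ring]
  field_simp
  ring

end Coefficients

section Series

/-- The power series in the definition of `P_ν^{-μ}`. -/
noncomputable def ferrersSeries (ν μ s : ℂ) : ℂ := ∑' n, ferrersCoeff ν μ n * s ^ n

/-- The power series in `t / √(1 - t²)` expanding `P_ν^{-μ}`. -/
noncomputable def expansionSeries (ν μ z : ℂ) : ℂ := ∑' n, expansionCoeff ν μ n * z ^ n

theorem differentiableAt_ferrersSeries (ν μ : ℂ) {s : ℂ} (hs : ‖s‖ < 1) :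
    DifferentiableAt ℂ (ferrersSeries ν μ) s :=
  (unitDiscSummable_ferrersCoeff ν μ).differentiableAt hs

theorem differentiableAt_expansionSeries (ν μ : ℂ) {z : ℂ} (hz : ‖z‖ < 1) :
    DifferentiableAt ℂ (expansionSeries ν μ) z :=
  (unitDiscSummable_expansionCoeff ν μ).differentiableAt hz

theorem ferrersSeries_ladder (ν μ : ℂ) {s : ℂ} (hs : ‖s‖ < 1) :
    (ν - μ - 2 * ν * s) * ferrersSeries ν μ s - 2 * s * (1 - s) * deriv (ferrersSeries ν μ) s =
      (ν - μ) * ferrersSeries (ν - 1) μ s := by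
  have h0 : HasSum (fun n => ferrersCoeff ν μ n * s ^ n) (ferrersSeries ν μ s) :=
    ((unitDiscSummable_ferrersCoeff ν μ).summable hs).hasSum
  have h1 : HasSum (fun n => ferrersCoeff (ν - 1) μ n * s ^ n) (ferrersSeries (ν - 1) μ s) :=
    ((unitDiscSummable_ferrersCoeff (ν - 1) μ).summable hs).hasSum
  have hd : HasSum (fun n : ℕ => (n : ℂ) * ferrersCoeff ν μ n * s ^ n)
      (s * deriv (ferrersSeries ν μ) s) := by
    rw [← hasSum_nat_add_iff' 1]
    simp only [Finset.range_one, Finset.sum_singleton, Nat.cast_zero, zero_mul, sub_zero]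
    refine (((unitDiscSummable_ferrersCoeff ν μ).hasSum_deriv hs).mul_left s).congr_fun
      fun n => ?_
    push_cast
    ring
  have hl := ((h0.mul_left (ν - μ)).sub (hd.mul_left 2)).sub (h1.mul_left (ν - μ))
  have hr := ((h0.mul_left (2 * ν)).sub (hd.mul_left 2)).mul_left s
  rw [← hasSum_nat_add_iff' 1] at hl
  have hz : ferrersCoeff (ν - 1) μ 0 = ferrersCoeff ν μ 0 := by simp [ferrersCoeff, pochC_zero]
  have key := hl.unique (hr.congr_fun fun n => ?_)
  · simp only [Finset.range_one, Finset.sum_singleton, hz, Nat.cast_zero] at key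
    linear_combination key
  · push_cast
    linear_combination s ^ (n + 1) * ferrersCoeff_ladder ν μ n

theorem deriv_expansionSeries (ν μ : ℂ) {z : ℂ} (hz : ‖z‖ < 1) :
    deriv (expansionSeries ν μ) z = (ν - μ) * expansionSeries (ν - 1) μ z := by
  have h1 : HasSum (fun n => expansionCoeff (ν - 1) μ n * z ^ n) (expansionSeries (ν - 1) μ z) :=
    ((unitDiscSummable_expansionCoeff (ν - 1) μ).summable hz).hasSum
  refine ((unitDiscSummable_expansionCoeff ν μ).hasSum_deriv hz).unique
    ((h1.mul_left (ν - μ)).congr_fun fun n => ?_)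
  linear_combination z ^ n * expansionCoeff_ladder ν μ n

theorem expansionSeries_zero (ν μ : ℂ) :
    expansionSeries ν μ 0 =
      (Complex.Gamma ((μ - ν + 1) / 2) * Complex.Gamma ((μ + ν + 2) / 2))⁻¹ := by
  rw [expansionSeries, tsum_eq_single 0 fun n hn => by simp [hn]]
  simp [expansionCoeff, pochC_zero]

end Series

section Bailey

theorem ferrersCoeff_telescope (ν μ : ℂ) (n : ℕ) :
    ferrersCoeff ν μ n * (1 / 2) ^ n -
        (μ - ν + 1) * (μ + ν + 2) * (ferrersCoeff ν (μ + 2) n * (1 / 2) ^ n) =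
      -2 * ((n + 1 : ℕ) : ℂ) * ferrersCoeff ν (μ + 1) (n + 1) * (1 / 2) ^ (n + 1) -
        -2 * (n : ℂ) * ferrersCoeff ν (μ + 1) n * (1 / 2) ^ n := by
  have h1 := Gamma_inv_eq_mul ((n : ℂ) + 1 + μ)
  have h2 := Gamma_inv_eq_mul ((n : ℂ) + 1 + (μ + 1))
  have hn : (n : ℂ) + 1 ≠ 0 := Nat.cast_add_one_ne_zero n
  have hf : (n.factorial : ℂ) ≠ 0 := Nat.cast_ne_zero.mpr n.factorial_ne_zero
  rw [show (n : ℂ) + 1 + μ + 1 = (n : ℂ) + 1 + (μ + 1) by ring, h2,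
    show (n : ℂ) + 1 + (μ + 1) + 1 = (n : ℂ) + 1 + (μ + 2) by ring] at h1
  rw [show (n : ℂ) + 1 + (μ + 1) + 1 = (n : ℂ) + 1 + (μ + 2) by ring] at h2
  simp only [ferrersCoeff, pochC_succ, Nat.factorial_succ, Nat.cast_mul, Nat.cast_add,
    Nat.cast_one, div_eq_mul_inv, mul_inv,
    show (n : ℂ) + 1 + 1 + (μ + 1) = (n : ℂ) + 1 + (μ + 2) by ring]
  rw [h1, h2]
  field_simp
  ring

theorem ferrersSeries_half_add_two (ν μ : ℂ) :
    ferrersSeries ν μ (1 / 2) =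
      (μ - ν + 1) * (μ + ν + 2) * ferrersSeries ν (μ + 2) (1 / 2) := by
  have hs : ‖(1 / 2 : ℂ)‖ < 1 := by norm_num
  have h0 : HasSum (fun n => ferrersCoeff ν μ n * (1 / 2) ^ n) (ferrersSeries ν μ (1 / 2)) :=
    ((unitDiscSummable_ferrersCoeff ν μ).summable hs).hasSum
  have h2 : HasSum (fun n => ferrersCoeff ν (μ + 2) n * (1 / 2) ^ n)
      (ferrersSeries ν (μ + 2) (1 / 2)) :=
    ((unitDiscSummable_ferrersCoeff ν (μ + 2)).summable hs).hasSum
  have h := (h0.sub (h2.mul_left ((μ - ν + 1) * (μ + ν + 2)))).tendsto_sum_nat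
  simp only [ferrersCoeff_telescope] at h
  have hG : Tendsto (fun n : ℕ => -2 * (n : ℂ) * ferrersCoeff ν (μ + 1) n * (1 / 2) ^ n) atTop
      (𝓝 0) := by
    rw [← tendsto_add_atTop_iff_nat 1]
    have := (((unitDiscSummable_ferrersCoeff ν (μ + 1)).hasSum_deriv
      hs).summable.tendsto_atTop_zero).const_mul (-1)
    rw [mul_zero] at this
    refine this.congr fun n => ?_
    push_cast
    ring
  have hS := tendsto_nhds_unique h <| hG.congr fun N => by
    rw [Finset.sum_range_sub (fun n : ℕ => -2 * (n : ℂ) * ferrersCoeff ν (μ + 1) n * (1 / 2) ^ n)]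
    simp
  linear_combination hS

theorem re_mul_factorial_le_norm_pochC {x : ℂ} (hx : 1 ≤ x.re) (n : ℕ) :
    x.re * ((n + 1).factorial : ℝ) ≤ ‖pochC x (n + 1)‖ := by
  induction n with
  | zero => simpa [pochC_succ, pochC_zero] using Complex.re_le_norm x
  | succ n ih =>
    rw [pochC_succ, norm_mul, Nat.factorial_succ (n + 1)]
    have h : ((n + 1 + 1 : ℕ) : ℝ) ≤ ‖x + ((n + 1 : ℕ) : ℂ)‖ := by
      refine le_trans ?_ (Complex.re_le_norm _)
      simp only [Nat.cast_add, Nat.cast_one, Complex.add_re, Complex.natCast_re, Complex.one_re]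
      linarith
    calc x.re * ((n + 1 + 1) * (n + 1).factorial : ℕ)
        = (x.re * (n + 1).factorial) * ((n + 1 + 1 : ℕ) : ℝ) := by push_cast; ring
      _ ≤ _ := by gcongr

theorem Gamma_add_nat {x : ℂ} (hx : 0 < x.re) (n : ℕ) :
    Complex.Gamma (x + n) = pochC x n * Complex.Gamma x := by
  induction n with
  | zero => simp [pochC_zero]
  | succ n ih =>
    have : x + n ≠ 0 := by
      intro h
      have := congrArg Complex.re h
      simp at this
      linarith [n.cast_nonneg (α := ℝ)]
    rw [pochC_succ, Nat.cast_succ, ← add_assoc, Complex.Gamma_add_one _ this, ih]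
    ring

theorem tendsto_cpow_mul_factorial_div_Gamma {s : ℂ} (hs : 0 < s.re) :
    Tendsto (fun n : ℕ => (n : ℂ) ^ s * (n.factorial : ℂ) / Complex.Gamma (s + ((n + 1 : ℕ) : ℂ)))
      atTop (𝓝 1) := by
  have hne := Complex.Gamma_ne_zero_of_re_pos hs
  have h := (Complex.GammaSeq_tendsto_Gamma s).div_const (Complex.Gamma s)
  rw [div_self hne] at h
  refine h.congr fun n => ?_
  have hprod : ∀ m : ℕ, pochC s m = ∏ j ∈ Finset.range m, (s + j) := fun m => by
    induction m with
    | zero => simp [pochC_zero]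
    | succ m ih => rw [pochC_succ, ih, Finset.prod_range_succ]
  rw [Complex.GammaSeq, Gamma_add_nat hs, div_div, hprod]

theorem norm_Gamma_mul_ferrersSeries_half_sub_one_le (ν : ℂ) {μ : ℂ} (hμ : 0 ≤ μ.re) :
    ‖Complex.Gamma (μ + 1) * ferrersSeries ν μ (1 / 2) - 1‖ ≤
      (∑' n, ‖ferrersCoeff ν 0 (n + 1)‖ * (1 / 2) ^ (n + 1)) / (μ.re + 1) := by
  have hs : ‖(1 / 2 : ℂ)‖ < 1 := by norm_num
  have hre : 1 ≤ (μ + 1).re := by simpa using hμ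
  have hΓ : Complex.Gamma (μ + 1) ≠ 0 := Complex.Gamma_ne_zero_of_re_pos (by linarith)
  have hsum := (unitDiscSummable_ferrersCoeff ν 0) (1 / 2) (by norm_num) (by norm_num)
  have h0 : HasSum (fun n => ferrersCoeff ν μ n * (1 / 2) ^ n) (ferrersSeries ν μ (1 / 2)) :=
    ((unitDiscSummable_ferrersCoeff ν μ).summable hs).hasSum
  have h1 := (hasSum_nat_add_iff' 1).mpr (h0.mul_left (Complex.Gamma (μ + 1)))
  have hz : Complex.Gamma (μ + 1) * (ferrersCoeff ν μ 0 * (1 / 2) ^ 0) = 1 := by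
    simp [ferrersCoeff, pochC_zero, add_comm 1 μ, hΓ]
  rw [Finset.sum_range_one, hz] at h1
  rw [← h1.tsum_eq, ← tsum_div_const]
  refine tsum_of_norm_bounded (((summable_nat_add_iff 1).mpr hsum).div_const _).hasSum fun n => ?_
  have hp := re_mul_factorial_le_norm_pochC hre n
  have hfac : (0 : ℝ) < ((n + 1).factorial : ℝ) := mod_cast (n + 1).factorial_pos
  have hre' : (μ + 1).re = μ.re + 1 := by simp
  rw [hre'] at hp
  have hΓn : Complex.Gamma (((n + 1 : ℕ) : ℂ) + 1 + μ) =
      pochC (μ + 1) (n + 1) * Complex.Gamma (μ + 1) := by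
    rw [← Gamma_add_nat (by linarith)]
    congr 1
    ring
  have hΓ0 : Complex.Gamma (((n + 1 : ℕ) : ℂ) + 1 + 0) = ((n + 1).factorial : ℂ) := by
    rw [add_zero, Complex.Gamma_nat_eq_factorial]
  have hpos : 0 < (μ.re + 1) * ((n + 1).factorial : ℝ) := by positivity
  simp only [ferrersCoeff, hΓn, hΓ0, norm_mul, norm_div, norm_pow, Complex.norm_natCast]
  have hΓ' : ‖Complex.Gamma (μ + 1)‖ ≠ 0 := norm_ne_zero_iff.mpr hΓ
  have hp0 : 0 < ‖pochC (μ + 1) (n + 1)‖ := hpos.trans_le hp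
  rw [norm_one, Complex.norm_ofNat]
  calc _ = ‖pochC (-ν) (n + 1)‖ * ‖pochC (ν + 1) (n + 1)‖ / ((n + 1).factorial : ℝ) *
          (1 / 2) ^ (n + 1) * (1 / ‖pochC (μ + 1) (n + 1)‖) := by
        field_simp
    _ ≤ ‖pochC (-ν) (n + 1)‖ * ‖pochC (ν + 1) (n + 1)‖ / ((n + 1).factorial : ℝ) *
          (1 / 2) ^ (n + 1) * (1 / ((μ.re + 1) * ((n + 1).factorial : ℝ))) := by
        gcongr
    _ = _ := by
        field_simp

theorem tendsto_Gamma_mul_Gamma_div {a b c d : ℂ} (ha : 0 < a.re) (hb : 0 < b.re) (hc : 0 < c.re)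
    (hd : 0 < d.re) (h : a + b = c + d) :
    Tendsto (fun n : ℕ =>
      Complex.Gamma (a + ((n + 1 : ℕ) : ℂ)) * Complex.Gamma (b + ((n + 1 : ℕ) : ℂ)) /
        (Complex.Gamma (c + ((n + 1 : ℕ) : ℂ)) * Complex.Gamma (d + ((n + 1 : ℕ) : ℂ))))
      atTop (𝓝 1) := by
  have hlim := ((tendsto_cpow_mul_factorial_div_Gamma hc).mul
    (tendsto_cpow_mul_factorial_div_Gamma hd)).div
    ((tendsto_cpow_mul_factorial_div_Gamma ha).mul
      (tendsto_cpow_mul_factorial_div_Gamma hb)) (by simp)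
  simp only [mul_one, div_one] at hlim
  refine hlim.congr' ?_
  filter_upwards [eventually_ne_atTop 0] with n hn
  have hn0 : (n : ℂ) ≠ 0 := Nat.cast_ne_zero.mpr hn
  have hf : (n.factorial : ℂ) ≠ 0 := Nat.cast_ne_zero.mpr n.factorial_ne_zero
  have hcd : (n : ℂ) ^ c * (n : ℂ) ^ d = (n : ℂ) ^ a * (n : ℂ) ^ b := by
    rw [← Complex.cpow_add _ _ hn0, ← Complex.cpow_add _ _ hn0, h]
  have hna : (n : ℂ) ^ a ≠ 0 := by simp [Complex.cpow_eq_zero_iff, hn0]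
  have hnb : (n : ℂ) ^ b ≠ 0 := by simp [Complex.cpow_eq_zero_iff, hn0]
  have hre : ∀ s : ℂ, 0 < s.re → Complex.Gamma (s + ((n + 1 : ℕ) : ℂ)) ≠ 0 := fun s hs =>
    Complex.Gamma_ne_zero_of_re_pos (by
      simp only [Complex.add_re, Complex.natCast_re]
      positivity)
  have h1 := hre a ha
  have h2 := hre b hb
  have h3 := hre c hc
  have h4 := hre d hd
  simp only [Pi.div_apply]
  generalize Complex.Gamma (a + ((n + 1 : ℕ) : ℂ)) = A at *
  generalize Complex.Gamma (b + ((n + 1 : ℕ) : ℂ)) = B at *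
  generalize Complex.Gamma (c + ((n + 1 : ℕ) : ℂ)) = C at *
  generalize Complex.Gamma (d + ((n + 1 : ℕ) : ℂ)) = D at *
  field_simp
  linear_combination hcd

theorem tendsto_Gamma_mul_ferrersSeries_half (ν : ℂ) {μ : ℂ} (hμ : 0 ≤ μ.re) :
    Tendsto (fun n : ℕ => Complex.Gamma (μ + 2 * ((n + 1 : ℕ) : ℂ) + 1) *
      ferrersSeries ν (μ + 2 * ((n + 1 : ℕ) : ℂ)) (1 / 2)) atTop (𝓝 1) := by
  rw [tendsto_iff_norm_sub_tendsto_zero]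
  have hre : ∀ n : ℕ, (μ + 2 * ((n + 1 : ℕ) : ℂ)).re = μ.re + 2 * ((n : ℝ) + 1) := by simp
  refine squeeze_zero (fun n => norm_nonneg _) (fun n =>
    norm_Gamma_mul_ferrersSeries_half_sub_one_le ν (by rw [hre]; positivity)) ?_
  refine Tendsto.const_div_atTop ?_ _
  refine tendsto_atTop_mono (fun n => ?_) tendsto_natCast_atTop_atTop
  rw [hre]
  linarith [n.cast_nonneg (α := ℝ)]

theorem ferrersSeries_half_of_norm_lt (ν : ℂ) {μ : ℂ} (hμ : ‖ν‖ < μ.re) :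
    ferrersSeries ν μ (1 / 2) = (Real.sqrt Real.pi : ℂ) / (2 : ℂ) ^ μ *
      (Complex.Gamma ((μ - ν + 1) / 2) * Complex.Gamma ((μ + ν + 2) / 2))⁻¹ := by
  have h2 : (2 : ℂ) ≠ 0 := two_ne_zero
  have hsqrt : (Real.sqrt Real.pi : ℂ) ≠ 0 :=
    Complex.ofReal_ne_zero.mpr (Real.sqrt_pos.mpr Real.pi_pos).ne'
  have hpow : ∀ z : ℂ, (2 : ℂ) ^ z ≠ 0 := fun z => by simp [Complex.cpow_eq_zero_iff]
  have hν := abs_le.mp (Complex.abs_re_le_norm ν)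
  have hν0 := norm_nonneg ν
  have hα : 0 < ((μ - ν + 1) / 2).re := by simp; linarith
  have hβ : 0 < ((μ + ν + 2) / 2).re := by simp; linarith
  have hγ : 0 < ((μ + 1) / 2).re := by simp; linarith
  have hδ : 0 < ((μ + 1) / 2 + 1 / 2).re := by simp; linarith
  have hne : ∀ (z : ℂ) (n : ℕ), 0 < z.re → z + n ≠ 0 := fun z n hz h => by
    have := congrArg Complex.re h
    simp at this
    linarith [n.cast_nonneg (α := ℝ)]
  have hiter : ∀ n : ℕ, ferrersSeries ν μ (1 / 2) *
      (Complex.Gamma ((μ - ν + 1) / 2) * Complex.Gamma ((μ + ν + 2) / 2) * 2 ^ μ) =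
      ferrersSeries ν (μ + 2 * (n : ℂ)) (1 / 2) *
        (Complex.Gamma ((μ - ν + 1) / 2 + n) * Complex.Gamma ((μ + ν + 2) / 2 + n) *
          2 ^ (μ + 2 * (n : ℂ))) := fun n => by
    induction n with
    | zero => simp
    | succ n ih =>
      rw [ih, ferrersSeries_half_add_two, Nat.cast_succ, ← add_assoc, ← add_assoc,
        Complex.Gamma_add_one _ (hne _ n hα), Complex.Gamma_add_one _ (hne _ n hβ),
        show μ + 2 * ((n : ℂ) + 1) = μ + 2 * n + 2 by ring, Complex.cpow_add _ 2 h2,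
        Complex.cpow_ofNat]
      ring
  have hlim := (tendsto_Gamma_mul_ferrersSeries_half ν (hν0.trans hμ.le)).mul
    (tendsto_Gamma_mul_Gamma_div hα hβ hγ hδ (by ring))
  rw [mul_one] at hlim
  have hconst : ∀ n : ℕ, ferrersSeries ν μ (1 / 2) *
      (Complex.Gamma ((μ - ν + 1) / 2) * Complex.Gamma ((μ + ν + 2) / 2) * 2 ^ μ) /
        (Real.sqrt Real.pi : ℂ) =
      Complex.Gamma (μ + 2 * ((n + 1 : ℕ) : ℂ) + 1) *
        ferrersSeries ν (μ + 2 * ((n + 1 : ℕ) : ℂ)) (1 / 2) *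
      (Complex.Gamma ((μ - ν + 1) / 2 + ((n + 1 : ℕ) : ℂ)) *
          Complex.Gamma ((μ + ν + 2) / 2 + ((n + 1 : ℕ) : ℂ)) /
        (Complex.Gamma ((μ + 1) / 2 + ((n + 1 : ℕ) : ℂ)) *
          Complex.Gamma ((μ + 1) / 2 + 1 / 2 + ((n + 1 : ℕ) : ℂ)))) := fun n => by
    have hdup := Complex.Gamma_mul_Gamma_add_half ((μ + 1) / 2 + ((n + 1 : ℕ) : ℂ))
    rw [show 2 * ((μ + 1) / 2 + ((n + 1 : ℕ) : ℂ)) = μ + 2 * ((n + 1 : ℕ) : ℂ) + 1 by ring,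
      show 1 - (μ + 2 * ((n + 1 : ℕ) : ℂ) + 1) = -(μ + 2 * ((n + 1 : ℕ) : ℂ)) by ring,
      Complex.cpow_neg, show (μ + 1) / 2 + ((n + 1 : ℕ) : ℂ) + 1 / 2 =
        (μ + 1) / 2 + 1 / 2 + ((n + 1 : ℕ) : ℂ) by ring] at hdup
    have hΓ : Complex.Gamma (μ + 2 * ((n + 1 : ℕ) : ℂ) + 1) ≠ 0 :=
      Complex.Gamma_ne_zero_of_re_pos (by simp; linarith [n.cast_nonneg (α := ℝ)])
    rw [hiter (n + 1), hdup]
    have hp := hpow (μ + 2 * ((n + 1 : ℕ) : ℂ))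
    field_simp
  have hone := tendsto_nhds_unique (tendsto_const_nhds.congr hconst) hlim
  have h3 := Complex.Gamma_ne_zero_of_re_pos hα
  have h4 := Complex.Gamma_ne_zero_of_re_pos hβ
  have h5 := hpow μ
  rw [div_eq_one_iff_eq hsqrt] at hone
  rw [← hone]
  field_simp

theorem ferrersSeries_half (ν μ : ℂ) :
    ferrersSeries ν μ (1 / 2) = (Real.sqrt Real.pi : ℂ) / (2 : ℂ) ^ μ *
      (Complex.Gamma ((μ - ν + 1) / 2) * Complex.Gamma ((μ + ν + 2) / 2))⁻¹ := by
  obtain ⟨N, hN⟩ := exists_nat_gt (‖ν‖ - μ.re)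
  have hlt : ‖ν‖ < μ.re + 2 * N := by
    have := N.cast_nonneg (α := ℝ)
    linarith
  clear hN
  induction N generalizing μ with
  | zero => exact ferrersSeries_half_of_norm_lt ν (by simpa using hlt)
  | succ N ih =>
    have h := ih (μ + 2) (by push_cast at hlt; simp; linarith)
    rw [ferrersSeries_half_add_two, h, mul_inv, mul_inv,
      Gamma_inv_eq_mul ((μ - ν + 1) / 2), Gamma_inv_eq_mul ((μ + ν + 2) / 2),
      show (μ + 2 - ν + 1) / 2 = (μ - ν + 1) / 2 + 1 by ring,
      show (μ + 2 + ν + 2) / 2 = (μ + ν + 2) / 2 + 1 by ring,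
      Complex.cpow_add _ 2 two_ne_zero, Complex.cpow_ofNat]
    have hpow : (2 : ℂ) ^ μ ≠ 0 := by simp [Complex.cpow_eq_zero_iff]
    field_simp

end Bailey

section Continuation

open Complex

variable {t : ℂ}

/-- The factor `(1 - t²)^{-1/2}`. -/
noncomputable def invSqrtOneSubSq (t : ℂ) : ℂ := exp (-(1 / 2) * log (1 - t ^ 2))

/-- The factor `(1 - t)^{μ/2} (1 + t)^{-μ/2} (1 - t²)^{-ν/2}`. -/
noncomputable def legendrePrefactor (ν μ t : ℂ) : ℂ :=
  exp (μ / 2 * (log (1 - t) - log (1 + t)) - ν / 2 * log (1 - t ^ 2))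

/-- The difference between `(1 - t²)^{-ν/2} P_ν^{-μ}(t)` and its expansion. -/
noncomputable def expansionDefect (ν μ t : ℂ) : ℂ :=
  legendrePrefactor ν μ t * ferrersSeries ν μ ((1 - t) / 2) -
    (Real.sqrt Real.pi : ℂ) / (2 : ℂ) ^ μ * expansionSeries ν μ (t * invSqrtOneSubSq t)

theorem norm_sq_lt_half (ht : ‖t‖ < Real.sqrt 2 / 2) : ‖t‖ ^ 2 < 1 / 2 := by
  have h2 : Real.sqrt 2 ^ 2 = 2 := Real.sq_sqrt (by norm_num)
  nlinarith [norm_nonneg t, Real.sqrt_nonneg 2]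

theorem norm_lt_one_of_lt_sqrt_two_div_two (ht : ‖t‖ < Real.sqrt 2 / 2) : ‖t‖ < 1 := by
  nlinarith [norm_sq_lt_half ht, norm_nonneg t]

theorem one_add_mem_slitPlane (ht : ‖t‖ < Real.sqrt 2 / 2) : 1 + t ∈ slitPlane :=
  mem_slitPlane_of_norm_lt_one (norm_lt_one_of_lt_sqrt_two_div_two ht)

theorem one_sub_mem_slitPlane (ht : ‖t‖ < Real.sqrt 2 / 2) : 1 - t ∈ slitPlane := by
  rw [sub_eq_add_neg]
  exact one_add_mem_slitPlane (by rwa [norm_neg])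

theorem one_sub_sq_mem_slitPlane (ht : ‖t‖ < Real.sqrt 2 / 2) : 1 - t ^ 2 ∈ slitPlane := by
  rw [sub_eq_add_neg]
  refine mem_slitPlane_of_norm_lt_one ?_
  rw [norm_neg, norm_pow]
  linarith [norm_sq_lt_half ht]

theorem norm_one_sub_div_two_lt_one (ht : ‖t‖ < Real.sqrt 2 / 2) : ‖(1 - t) / 2‖ < 1 := by
  have h := norm_sub_le 1 t
  have h1 := norm_lt_one_of_lt_sqrt_two_div_two ht
  rw [norm_div, Complex.norm_ofNat]
  rw [norm_one] at h
  linarith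

theorem invSqrtOneSubSq_sq (ht : ‖t‖ < Real.sqrt 2 / 2) :
    invSqrtOneSubSq t ^ 2 = (1 - t ^ 2)⁻¹ := by
  rw [invSqrtOneSubSq, ← exp_nat_mul]
  rw [show ((2 : ℕ) : ℂ) * (-(1 / 2) * log (1 - t ^ 2)) = -log (1 - t ^ 2) by push_cast; ring,
    exp_neg, exp_log (slitPlane_ne_zero (one_sub_sq_mem_slitPlane ht))]

theorem norm_mul_invSqrtOneSubSq_lt_one (ht : ‖t‖ < Real.sqrt 2 / 2) :
    ‖t * invSqrtOneSubSq t‖ < 1 := by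
  rw [← sq_lt_one_iff₀ (norm_nonneg _), ← norm_pow, mul_pow, invSqrtOneSubSq_sq ht, norm_mul,
    norm_inv, norm_pow, ← div_eq_mul_inv]
  have h := norm_sq_lt_half ht
  have h1 : 1 - ‖t‖ ^ 2 ≤ ‖1 - t ^ 2‖ := by
    rw [← norm_pow]
    simpa only [norm_one] using norm_sub_norm_le 1 (t ^ 2)
  rw [div_lt_one (by linarith)]
  linarith

theorem hasDerivAt_log_one_sub_sq (ht : ‖t‖ < Real.sqrt 2 / 2) :
    HasDerivAt (fun t => log (1 - t ^ 2)) (-(2 * t) / (1 - t ^ 2)) t := by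
  simpa using (((hasDerivAt_id t).pow 2).const_sub 1).clog (one_sub_sq_mem_slitPlane ht)

theorem hasDerivAt_invSqrtOneSubSq (ht : ‖t‖ < Real.sqrt 2 / 2) :
    HasDerivAt invSqrtOneSubSq (invSqrtOneSubSq t * (t / (1 - t ^ 2))) t := by
  refine ((hasDerivAt_log_one_sub_sq ht).const_mul (-(1 / 2))).cexp.congr_deriv ?_
  rw [invSqrtOneSubSq]
  ring

theorem hasDerivAt_legendrePrefactor (ν μ : ℂ) (ht : ‖t‖ < Real.sqrt 2 / 2) :
    HasDerivAt (legendrePrefactor ν μ)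
      (legendrePrefactor ν μ t * ((ν * t - μ) / (1 - t ^ 2))) t := by
  have h1 := ((hasDerivAt_id t).const_sub 1).clog (one_sub_mem_slitPlane ht)
  have h2 := ((hasDerivAt_id t).const_add 1).clog (one_add_mem_slitPlane ht)
  refine (((h1.sub h2).const_mul (μ / 2)).sub
    ((hasDerivAt_log_one_sub_sq ht).const_mul (ν / 2))).cexp.congr_deriv ?_
  have e1 := slitPlane_ne_zero (one_sub_mem_slitPlane ht)
  have e2 := slitPlane_ne_zero (one_add_mem_slitPlane ht)
  simp only [legendrePrefactor, id, Pi.sub_apply]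
  rw [show 1 - t ^ 2 = (1 - t) * (1 + t) by ring]
  field_simp
  ring

theorem legendrePrefactor_eq_mul (ν μ t : ℂ) :
    legendrePrefactor ν μ t = legendrePrefactor (ν - 1) μ t * invSqrtOneSubSq t := by
  rw [legendrePrefactor, legendrePrefactor, invSqrtOneSubSq, ← exp_add]
  ring_nf

theorem hasDerivAt_expansionDefect (ν μ : ℂ) (ht : ‖t‖ < Real.sqrt 2 / 2) :
    HasDerivAt (expansionDefect ν μ)
      ((ν - μ) * invSqrtOneSubSq t / (1 - t ^ 2) * expansionDefect (ν - 1) μ t) t := by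
  have hs := norm_one_sub_div_two_lt_one ht
  have hz := norm_mul_invSqrtOneSubSq_lt_one ht
  have h0 := slitPlane_ne_zero (one_sub_sq_mem_slitPlane ht)
  have hw := invSqrtOneSubSq_sq ht
  have hF := (differentiableAt_ferrersSeries ν μ hs).hasDerivAt.comp t
    (((hasDerivAt_id t).const_sub 1).div_const 2)
  have hE := (differentiableAt_expansionSeries ν μ hz).hasDerivAt.comp t
    ((hasDerivAt_id t).mul (hasDerivAt_invSqrtOneSubSq ht))
  refine (((hasDerivAt_legendrePrefactor ν μ ht).mul hF).sub (hE.const_mul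
    ((Real.sqrt Real.pi : ℂ) / (2 : ℂ) ^ μ))).congr_deriv ?_
  have hl := ferrersSeries_ladder ν μ hs
  rw [deriv_expansionSeries ν μ hz, expansionDefect]
  simp only [Function.comp_apply, id]
  rw [legendrePrefactor_eq_mul ν]
  generalize (Real.sqrt Real.pi : ℂ) / (2 : ℂ) ^ μ = K
  field_simp
  linear_combination 2 * legendrePrefactor (ν - 1) μ t * invSqrtOneSubSq t * hl

theorem expansionDefect_zero (ν μ : ℂ) : expansionDefect ν μ 0 = 0 := by
  simp only [expansionDefect, legendrePrefactor, sub_zero, add_zero, zero_mul, ferrersSeries_half,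
    expansionSeries_zero]
  simp [mul_comm]

theorem analyticOnNhd_expansionDefect (ν μ : ℂ) :
    AnalyticOnNhd ℂ (expansionDefect ν μ) (Metric.ball 0 (Real.sqrt 2 / 2)) :=
  DifferentiableOn.analyticOnNhd (fun _ ht => (hasDerivAt_expansionDefect ν μ
    (mem_ball_zero_iff.mp ht)).differentiableAt.differentiableWithinAt) Metric.isOpen_ball

theorem analyticAt_invSqrtOneSubSq_zero : AnalyticAt ℂ invSqrtOneSubSq 0 :=
  DifferentiableOn.analyticAt (s := Metric.ball 0 (Real.sqrt 2 / 2)) (fun _ ht =>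
    (hasDerivAt_invSqrtOneSubSq (mem_ball_zero_iff.mp ht)).differentiableAt.differentiableWithinAt)
    (Metric.ball_mem_nhds _ (by positivity))

theorem le_analyticOrderAt_expansionDefect (μ : ℂ) (n : ℕ) :
    ∀ ν, (n : ℕ∞) ≤ analyticOrderAt (expansionDefect ν μ) 0 := by
  have hball : Metric.ball (0 : ℂ) (Real.sqrt 2 / 2) ∈ 𝓝 0 :=
    Metric.ball_mem_nhds _ (by positivity)
  induction n with
  | zero => simp
  | succ n ih =>
    intro ν
    have hD : ∀ ν, AnalyticAt ℂ (expansionDefect ν μ) 0 := fun ν =>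
      analyticOnNhd_expansionDefect ν μ 0 (mem_of_mem_nhds hball)
    have hk : AnalyticAt ℂ (fun t => (ν - μ) * invSqrtOneSubSq t / (1 - t ^ 2)) 0 :=
      (analyticAt_const.mul analyticAt_invSqrtOneSubSq_zero).div (by fun_prop) (by simp)
    have h := (hD ν).analyticOrderAt_deriv_add_one
    simp only [expansionDefect_zero, sub_zero] at h
    have hderiv : deriv (expansionDefect ν μ) =ᶠ[𝓝 0]
        (fun t => (ν - μ) * invSqrtOneSubSq t / (1 - t ^ 2)) * expansionDefect (ν - 1) μ := by
      filter_upwards [hball] with t ht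
      exact (hasDerivAt_expansionDefect ν μ (mem_ball_zero_iff.mp ht)).deriv
    rw [← h, analyticOrderAt_congr hderiv, analyticOrderAt_mul hk (hD _), Nat.cast_succ]
    gcongr
    exact (ih (ν - 1)).trans le_add_self

theorem expansionDefect_eq_zero (ν μ : ℂ) (ht : ‖t‖ < Real.sqrt 2 / 2) :
    expansionDefect ν μ t = 0 := by
  have htop : analyticOrderAt (expansionDefect ν μ) 0 = ⊤ :=
    ENat.eq_top_iff_forall_ge.mpr fun n => le_analyticOrderAt_expansionDefect μ n ν
  exact (analyticOnNhd_expansionDefect ν μ).eqOn_zero_of_preconnected_of_eventuallyEq_zero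
    (convex_ball _ _).isPreconnected (Metric.mem_ball_self (by positivity))
    (analyticOrderAt_eq_top.mp htop) (mem_ball_zero_iff.mpr ht)

end Continuation

theorem stmt16 (ν μ : ℂ) (t : ℝ) (ht : |t| < Real.sqrt 2 / 2) :
    Summable (fun n : ℕ => (-1 : ℂ) ^ n * pochC (μ - ν) n * (t : ℂ) ^ n *
        ((1 - t ^ 2 : ℝ) : ℂ) ^ ((ν - (n : ℂ)) / 2) /
        (Complex.Gamma (((n : ℂ) + μ - ν + 1) / 2) * Complex.Gamma ((μ + ν - (n : ℂ) + 2) / 2) *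
          (n.factorial : ℂ))) ∧
      ferrersP ν (-μ) t =
        (Real.sqrt Real.pi : ℂ) / (2 : ℂ) ^ μ *
          ∑' n : ℕ, (-1 : ℂ) ^ n * pochC (μ - ν) n * (t : ℂ) ^ n *
            ((1 - t ^ 2 : ℝ) : ℂ) ^ ((ν - (n : ℂ)) / 2) /
            (Complex.Gamma (((n : ℂ) + μ - ν + 1) / 2) *
              Complex.Gamma ((μ + ν - (n : ℂ) + 2) / 2) * (n.factorial : ℂ)) := by
  have htc : ‖(t : ℂ)‖ < Real.sqrt 2 / 2 := by rwa [Complex.norm_real, Real.norm_eq_abs]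
  have hq0 := Complex.slitPlane_ne_zero (one_sub_sq_mem_slitPlane htc)
  have ht1 : |t| < 1 := by simpa using norm_lt_one_of_lt_sqrt_two_div_two htc
  obtain ⟨hneg, hpos⟩ := abs_lt.mp ht1
  have hsum := (unitDiscSummable_expansionCoeff ν μ).summable (norm_mul_invSqrtOneSubSq_lt_one htc)
  have hterm : ∀ n : ℕ, (-1 : ℂ) ^ n * pochC (μ - ν) n * (t : ℂ) ^ n *
        ((1 - t ^ 2 : ℝ) : ℂ) ^ ((ν - (n : ℂ)) / 2) /
        (Complex.Gamma (((n : ℂ) + μ - ν + 1) / 2) * Complex.Gamma ((μ + ν - (n : ℂ) + 2) / 2) *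
          (n.factorial : ℂ)) =
      Complex.exp (ν / 2 * Complex.log (1 - (t : ℂ) ^ 2)) *
        (expansionCoeff ν μ n * (t * invSqrtOneSubSq t) ^ n) := fun n => by
    have hcpow : ((1 - t ^ 2 : ℝ) : ℂ) ^ ((ν - (n : ℂ)) / 2) =
        Complex.exp (ν / 2 * Complex.log (1 - (t : ℂ) ^ 2)) * invSqrtOneSubSq t ^ n := by
      push_cast
      rw [Complex.cpow_def_of_ne_zero hq0, invSqrtOneSubSq, ← Complex.exp_nat_mul,
        ← Complex.exp_add]
      ring_nf
    rw [hcpow, expansionCoeff]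
    ring
  simp only [hterm]
  refine ⟨hsum.mul_left _, ?_⟩
  rw [tsum_mul_left]
  have hlog : Complex.log (((1 + t) / (1 - t) : ℝ) : ℂ) =
      Complex.log (1 + t) - Complex.log (1 - t) := by
    rw [← Complex.ofReal_log (div_pos (by linarith) (by linarith)).le,
      Real.log_div (by linarith) (by linarith), Complex.ofReal_sub,
      Complex.ofReal_log (by linarith), Complex.ofReal_log (by linarith)]
    push_cast
    rfl
  have hne : (((1 + t) / (1 - t) : ℝ) : ℂ) ≠ 0 :=
    Complex.ofReal_ne_zero.mpr (div_pos (by linarith) (by linarith)).ne'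
  have hpre : (((1 + t) / (1 - t) : ℝ) : ℂ) ^ (-μ / 2) =
      Complex.exp (ν / 2 * Complex.log (1 - (t : ℂ) ^ 2)) * legendrePrefactor ν μ t := by
    rw [Complex.cpow_def_of_ne_zero hne, hlog, legendrePrefactor, ← Complex.exp_add]
    ring_nf
  have hseries : ∑' n : ℕ, pochC (-ν) n * pochC (ν + 1) n /
        (Complex.Gamma ((n : ℂ) + 1 - -μ) * (n.factorial : ℂ)) *
      (((1 - t) / 2 : ℝ) : ℂ) ^ n = ferrersSeries ν μ ((1 - t) / 2) := by
    simp [ferrersSeries, ferrersCoeff]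
  have hdefect := expansionDefect_eq_zero ν μ htc
  rw [expansionDefect, sub_eq_zero] at hdefect
  rw [ferrersP, hpre, hseries, mul_assoc, hdefect, expansionSeries]
  ring
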